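/- Let Ω ⋐ Ω'' ⊂ Ω' with Ω'' open. Let u be the solution to the obstacle problem in K_{g,h}(Ω,Ω') and let v be a weak supersolution of Lv = 0 in Ω'' such that min{u,v} ∈ K_{g,h}(Ω,Ω'). Then u ≤ v almost everywhere in ℝ^n. -/

import Mathlib

open MeasureTheory Metric Filter
open scoped ENNReal Topology

noncomputable section

/-- `ℝ^n`. -/
abbrev Euc (n : ℕ) := EuclideanSpace ℝ (Fin n)

/-- `L(a,b) = |a-b|^{p-2}(a-b)` (real powers; the convention `L(a,a)=0` holds automatically). -/
noncomputable def Lf (p a b : ℝ) : ℝ := |a - b| ^ (p - 2) * (a - b)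

/-- A symmetric measurable kernel of order `(s,p)` with ellipticity constant `Λ`. -/
def IsKernel (n : ℕ) (s p Λ : ℝ) (K : Euc n → Euc n → ℝ) : Prop :=
  Measurable (Function.uncurry K) ∧
  (∀ x y, K x y = K y x) ∧ (∀ x y, 0 ≤ K x y) ∧
  (∀ᵐ z : Euc n × Euc n, Λ⁻¹ ≤ K z.1 z.2 * ‖z.1 - z.2‖ ^ ((n : ℝ) + s * p) ∧
    K z.1 z.2 * ‖z.1 - z.2‖ ^ ((n : ℝ) + s * p) ≤ Λ)

/-- Membership in the fractional Sobolev space `W^{s,p}(D)` (finiteness of the norm). -/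
def MemW (n : ℕ) (s p : ℝ) (D : Set (Euc n)) (v : Euc n → ℝ) : Prop :=
  AEMeasurable v (volume.restrict D) ∧
  IntegrableOn (fun x => |v x| ^ p) D volume ∧
  Integrable (fun q : Euc n × Euc n => |v q.1 - v q.2| ^ p / ‖q.1 - q.2‖ ^ ((n : ℝ) + s * p))
    ((volume.restrict D).prod (volume.restrict D))

/-- The `W^{s,p}(D)` norm. -/
noncomputable def sobNorm (n : ℕ) (s p : ℝ) (D : Set (Euc n)) (v : Euc n → ℝ) : ℝ :=
  (∫ x in D, |v x| ^ p) ^ (1/p) +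
  (∫ x in D, ∫ y in D, |v x - v y| ^ p / ‖x - y‖ ^ ((n : ℝ) + s * p)) ^ (1/p)

/-- The nonlocal tail `Tail(f; z, r)`. -/
noncomputable def tailF (n : ℕ) (s p : ℝ) (f : Euc n → ℝ) (z : Euc n) (r : ℝ) : ℝ :=
  (r ^ (s * p) * ∫ x in (ball z r)ᶜ, |f x| ^ (p - 1) * ‖x - z‖ ^ (-((n : ℝ) + s * p))) ^ (1/(p-1))

/-- Membership in the tail space `L^{p-1}_{sp}(ℝ^n)`. -/
def MemTail (n : ℕ) (s p : ℝ) (f : Euc n → ℝ) : Prop :=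
  AEMeasurable f volume ∧
  (∀ z : Euc n, ∀ r : ℝ, 0 < r → IntegrableOn (fun x => |f x| ^ (p - 1)) (ball z r) volume) ∧
  (∀ z : Euc n, ∀ r : ℝ, 0 < r →
    IntegrableOn (fun x => |f x| ^ (p - 1) * ‖x - z‖ ^ (-((n : ℝ) + s * p))) (ball z r)ᶜ volume)

/-- The admissible class `K_{g,h}(Ω,Ω')`. -/
def obstacleSet (n : ℕ) (s p : ℝ) (Ω Ω' : Set (Euc n)) (g : Euc n → ℝ) (h : Euc n → EReal) :
    Set (Euc n → ℝ) :=
  {u | MemW n s p Ω' u ∧ (∀ᵐ x ∂(volume : Measure (Euc n)), x ∈ Ω → h x ≤ (u x : EReal)) ∧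
    (∀ᵐ x ∂(volume : Measure (Euc n)), x ∉ Ω → u x = g x)}

/-- The functional `A u (v)`. -/
noncomputable def Aop (n : ℕ) (p : ℝ) (Ω Ω' : Set (Euc n)) (g : Euc n → ℝ)
    (K : Euc n → Euc n → ℝ) (u v : Euc n → ℝ) : ℝ :=
  (∫ x in Ω', ∫ y in Ω', Lf p (u x) (u y) * (v x - v y) * K x y) +
  2 * ∫ y in Ω'ᶜ, ∫ x in Ω, Lf p (u x) (g y) * v x * K x y

/-- `u` solves the obstacle problem in `K_{g,h}(Ω,Ω')`. -/
def SolvesObstacle (n : ℕ) (s p : ℝ) (Ω Ω' : Set (Euc n)) (g : Euc n → ℝ) (h : Euc n → EReal)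
    (K : Euc n → Euc n → ℝ) (u : Euc n → ℝ) : Prop :=
  u ∈ obstacleSet n s p Ω Ω' g h ∧
  ∀ v ∈ obstacleSet n s p Ω Ω' g h, 0 ≤ Aop n p Ω Ω' g K u (fun x => v x - u x)

/-- The essential oscillation of `f` on `A` (in `EReal`). -/
noncomputable def essOsc (n : ℕ) (A : Set (Euc n)) (f : Euc n → ℝ) : EReal :=
  essSup (fun x => (f x : EReal)) (volume.restrict A) -
    essInf (fun x => (f x : EReal)) (volume.restrict A)

end

/-- `w ∈ W^{s,p}_loc(D) ∩ L^{p-1}_{sp}(ℝ^n)` is a weak supersolution of `Lw = 0` in `D`. -/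
def IsWeakSupersol (n : ℕ) (s p : ℝ) (K : Euc n → Euc n → ℝ) (D : Set (Euc n))
    (w : Euc n → ℝ) : Prop :=
  (∀ D' : Set (Euc n), IsOpen D' → Bornology.IsBounded D' → closure D' ⊆ D → MemW n s p D' w) ∧
  MemTail n s p w ∧
  ∀ η : Euc n → ℝ, ContDiff ℝ (⊤ : ℕ∞) η → HasCompactSupport η → tsupport η ⊆ D → (∀ x, 0 ≤ η x) →
    0 ≤ ∫ x, ∫ y, K x y * Lf p (w x) (w y) * (η x - η y)


lemma obs_trans_cont {V X : Type*} [AddCommGroup V] [TopologicalSpace V] [MeasurableSpace V]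
    [OpensMeasurableSpace V]
    [TopologicalSpace X] [R1Space X] [MeasurableSpace X] [BorelSpace X]
    [AddAction V X] [ContinuousVAdd V X] {μ : Measure X} [IsLocallyFiniteMeasure μ]
    [μ.InnerRegularCompactLTTop] [VAddInvariantMeasure V X μ] 
    {p : ℝ≥0∞} (hp1 : 1 ≤ p) (hpt : p ≠ ∞) {f : X → ℝ} (hf : MemLp f p μ) :
    Tendsto (fun z : V => eLpNorm (fun x => f (z +ᵥ x) - f x) p μ) (𝓝 0) (𝓝 0) := by
  haveI : Fact (1 ≤ p) := ⟨hp1⟩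
  haveI : Fact (p ≠ ∞) := ⟨hpt⟩
  have h1 : Continuous (fun z : V => DomAddAct.mk z +ᵥ hf.toLp f) := by
    have : Continuous (fun z : V => DomAddAct.mk z) := DomAddAct.continuous_mk
    fun_prop
  have h2 : Tendsto (fun z : V => edist (DomAddAct.mk z +ᵥ hf.toLp f) (hf.toLp f)) (𝓝 0) (𝓝 0) := by
    have := (h1.tendsto 0).edist (tendsto_const_nhds (x := hf.toLp f))
    simpa using this
  refine h2.congr fun z => ?_
  rw [DomAddAct.mk_vadd_toLp, Lp.edist_toLp_toLp]
  rfl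

instance obs_vaddInv (n : ℕ) : VAddInvariantMeasure (Euc n) (Euc n × Euc n) (volume.prod volume) := by
  refine ⟨fun c s hs => ?_⟩
  have : MeasurePreserving (fun q : Euc n × Euc n => c +ᵥ q) (volume.prod volume) (volume.prod volume) :=
    (measurePreserving_add_left volume c).prod (measurePreserving_add_left volume c)
  exact this.measure_preimage hs.nullMeasurableSet

lemma obs_abs_Lf (p a b : ℝ) (hp : 1 < p) : |Lf p a b| = |a - b| ^ (p - 1) := by
  unfold Lf
  rw [abs_mul, abs_of_nonneg (by positivity)]
  rcases eq_or_ne (a - b) 0 with h | h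
  · rw [h]; simp [Real.zero_rpow (by linarith : p - 1 ≠ 0)]
  · have : 0 < |a - b| := abs_pos.mpr h
    nth_rewrite 2 [← Real.rpow_one |a - b|]
    rw [← Real.rpow_add this]; congr 1; ring

lemma obs_Lf_symm (p a b : ℝ) : Lf p a b = - Lf p b a := by
  unfold Lf; rw [abs_sub_comm]; ring

lemma obs_Lf_mono (p a b c d : ℝ) (hp : 1 < p) (h : a - b < c - d) : Lf p a b < Lf p c d := by
  have key : ∀ x y : ℝ, x < y → |x| ^ (p-2) * x < |y|^(p-2) * y := by
    have pos : ∀ x : ℝ, 0 < x → |x|^(p-2) * x = x ^ (p-1) := by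
      intro x hx
      rw [abs_of_pos hx]; nth_rewrite 2 [← Real.rpow_one x]
      rw [← Real.rpow_add hx]; congr 1; ring
    have pp : ∀ x : ℝ, 0 < x → 0 < |x|^(p-2) * x := fun x hx => by
      rw [pos x hx]; positivity
    have pm : ∀ x y : ℝ, 0 < x → x < y → |x| ^ (p-2) * x < |y|^(p-2) * y := fun x y hx hxy => by
      rw [pos x hx, pos y (hx.trans hxy)]
      exact Real.rpow_lt_rpow hx.le hxy (by linarith)
    have ng : ∀ x : ℝ, |x| ^ (p-2) * x = - (|-x|^(p-2) * (-x)) := fun x => by rw [abs_neg]; ring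
    intro x y hxy
    rcases lt_trichotomy x 0 with hx | hx | hx
    · rcases lt_trichotomy y 0 with hy | hy | hy
      · rw [ng x, ng y]; have := pm (-y) (-x) (by linarith) (by linarith); linarith
      · rw [ng x, hy]; have := pp (-x) (by linarith); simp only [mul_zero]; linarith
      · rw [ng x]; have := pp (-x) (by linarith); have := pp y hy; linarith
    · rw [hx]; simpa using pp y (by linarith)
    · exact pm x y hx hxy
  exact key _ _ h

lemma obs_P1 (k r A B N p Λ : ℝ) (hp : 1 < p) (hr : 0 < r) (hk : k * r ^ N ≤ Λ) :
    k * |A| ^ (p-1) * |B| ≤ Λ * (|A| / r ^ (N/p)) ^ (p-1) * (|B| / r^(N/p)) := by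
  have h1 : (r ^ (N/p)) ^ (p-1) * r ^ (N/p) = r ^ N := by
    rw [← Real.rpow_mul hr.le, ← Real.rpow_add hr]; congr 1
    field_simp; ring
  rw [Real.div_rpow (by positivity) (by positivity)]
  have e : Λ * (|A| ^ (p-1) / (r ^ (N/p)) ^ (p-1)) * (|B| / r^(N/p)) 
    = Λ / r ^ N * (|A| ^ (p-1) * |B|) := by
    rw [← h1]; field_simp
  rw [e, mul_assoc]
  refine mul_le_mul_of_nonneg_right ?_ (by positivity)
  rw [le_div_iff₀ (by positivity)]; exact hk

lemma obs_P2 (A B p : ℝ) (hp : 1 < p) :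
    |A - B| ^ (p-1) ≤ 2 ^ (p-1) * ((|A|^(p-1) + 1) * (|B|^(p-1)+1)) := by
  have hA : 0 ≤ |A|^(p-1) := by positivity
  have hB : 0 ≤ |B|^(p-1) := by positivity
  have h1 : |A - B| ≤ 2 * max |A| |B| := by
    have := abs_sub A B
    have := le_max_left |A| |B|
    have := le_max_right |A| |B|
    linarith
  have h2 : |A - B| ^ (p-1) ≤ (2 * max |A| |B|)^(p-1) :=
    Real.rpow_le_rpow (abs_nonneg _) h1 (by linarith)
  rw [Real.mul_rpow (by norm_num) (by positivity)] at h2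
  refine h2.trans (mul_le_mul_of_nonneg_left ?_ (by positivity))
  rcases max_choice |A| |B| with h | h <;> rw [h] <;> nlinarith [mul_nonneg hA hB]

lemma obs_P3 (r y N R δ : ℝ) (hN : 0 < N) (hδ : 0 < δ) (hR : 0 ≤ R) (hr : δ ≤ r) (hy0 : 0 ≤ y)
    (hy : y ≤ R + r) : (r ^ N)⁻¹ ≤ (1 + (1+R)/δ) ^ N * (1 + y) ^ (-N) := by
  have h0 : 0 < r := hδ.trans_le hr
  have h1 : 1 + y ≤ (1 + (1+R)/δ) * r := by
    have : (1 + R) ≤ (1+R)/δ * r := by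
      rw [div_mul_eq_mul_div, le_div_iff₀ hδ]; nlinarith
    linarith
  rw [Real.rpow_neg (by positivity), ← div_eq_mul_inv, le_div_iff₀ (by positivity), inv_mul_le_iff₀ (by positivity), mul_comm]
  rw [← Real.mul_rpow (by positivity) (by positivity)]
  exact Real.rpow_le_rpow (by positivity) h1 hN.le

/-- Normalised difference quotient. -/
noncomputable def obsPhi {n : ℕ} (N p : ℝ) (ψ : Euc n → ℝ) (q : Euc n × Euc n) : ℝ :=
  (ψ q.1 - ψ q.2) / ‖q.1 - q.2‖ ^ (N / p)

lemma obsPhi_meas {n : ℕ} (N p : ℝ) {ψ : Euc n → ℝ} (h : Measurable ψ) : Measurable (obsPhi N p ψ) := by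
  unfold obsPhi; fun_prop

lemma obs_memW {n : ℕ} {s p : ℝ} (hp : 1 < p) {D : Set (Euc n)} {w : Euc n → ℝ}
    (h : MemW n s p D w) :
    MemLp w (ENNReal.ofReal p) (volume.restrict D) ∧
    MemLp (obsPhi ((n:ℝ) + s * p) p w) (ENNReal.ofReal p)
      ((volume.restrict D).prod (volume.restrict D)) := by
  obtain ⟨h1, h2, h3⟩ := h
  have p0 : ENNReal.ofReal p ≠ 0 := by simp; linarith
  have pr : (ENNReal.ofReal p).toReal = p := ENNReal.toReal_ofReal (by linarith)
  constructor
  · rw [← integrable_norm_rpow_iff h1.aestronglyMeasurable p0 ENNReal.ofReal_ne_top, pr]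
    exact h2
  · have hm : AEMeasurable (obsPhi ((n:ℝ) + s * p) p w)
        ((volume.restrict D).prod (volume.restrict D)) := by
      unfold obsPhi
      have e1 : AEMeasurable (fun q : Euc n × Euc n => w q.1)
        ((volume.restrict D).prod (volume.restrict D)) := h1.comp_fst
      have e2 : AEMeasurable (fun q : Euc n × Euc n => w q.2)
        ((volume.restrict D).prod (volume.restrict D)) := h1.comp_snd
      refine (e1.sub e2).div ?_
      fun_prop
    rw [← integrable_norm_rpow_iff hm.aestronglyMeasurable p0 ENNReal.ofReal_ne_top, pr]
    refine h3.congr (Eventually.of_forall fun q => ?_)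
    simp only [obsPhi, norm_div, Real.norm_eq_abs]
    rw [Real.div_rpow (by positivity) (by positivity), abs_of_nonneg (a := ‖q.1 - q.2‖ ^ _) (by positivity),
      ← Real.rpow_mul (by positivity), div_mul_cancel₀ _ (by linarith)]

lemma obs_cross {n : ℕ} {N p Λ δ R : ℝ} (hN : 0 < N) (hp : 1 < p) (hδ : 0 < δ) (hR : 0 ≤ R)
    {x y : Euc n} {k : ℝ} (hk0 : 0 ≤ k) (hk : k * ‖x - y‖ ^ N ≤ Λ) (hΛ : 0 ≤ Λ)
    (hd : δ ≤ ‖x - y‖) (hx : ‖x‖ ≤ R) (w : Euc n → ℝ) (t : ℝ) :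
    ‖k * Lf p (w x) (w y) * t‖ₑ ≤ ENNReal.ofReal (Λ * (1 + (1+R)/δ) ^ N * 2 ^ (p-1)) *
      ((ENNReal.ofReal (|w x| ^ (p-1) + 1) * ‖t‖ₑ) *
        ENNReal.ofReal ((|w y| ^ (p-1) + 1) * (1 + ‖y‖) ^ (-N))) := by
  have hr : 0 < ‖x - y‖ := hδ.trans_le hd
  have h1 : k ≤ Λ * ((1 + (1+R)/δ) ^ N * (1 + ‖y‖) ^ (-N)) := by
    have hy : ‖y‖ ≤ R + ‖x - y‖ := by
      have : ‖y‖ ≤ ‖x‖ + ‖x - y‖ := by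
        have := norm_sub_le x (x - y)
        simpa using this
      linarith
    have := obs_P3 ‖x - y‖ ‖y‖ N R δ hN hδ hR hd (norm_nonneg _) hy
    calc k ≤ Λ * (‖x - y‖ ^ N)⁻¹ := by
          rw [← div_eq_mul_inv, le_div_iff₀ (by positivity)]; exact hk
      _ ≤ _ := mul_le_mul_of_nonneg_left this hΛ
  have h2 := obs_P2 (w x) (w y) p hp
  rw [Real.enorm_eq_ofReal_abs, Real.enorm_eq_ofReal_abs, ← ENNReal.ofReal_mul (by positivity),
    ← ENNReal.ofReal_mul (by positivity), ← ENNReal.ofReal_mul (by positivity)]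
  refine ENNReal.ofReal_le_ofReal ?_
  rw [abs_mul, abs_mul, obs_abs_Lf _ _ _ hp, abs_of_nonneg hk0]
  calc k * |w x - w y| ^ (p-1) * |t| ≤ (Λ * ((1 + (1+R)/δ) ^ N * (1 + ‖y‖) ^ (-N))) *
        (2 ^ (p-1) * ((|w x|^(p-1) + 1) * (|w y|^(p-1)+1))) * |t| := by gcongr
    _ = _ := by ring

/-- Geometric hypothesis: `E` is bounded by `R` and at distance `δ` from the complement of `D`. -/
structure ObsGeom {n : ℕ} (E D : Set (Euc n)) (δ R : ℝ) : Prop where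
  hδ : 0 < δ
  hR : 0 ≤ R
  hE : ∀ x ∈ E, ‖x‖ ≤ R
  hd : ∀ x ∈ E, ∀ y ∉ D, δ ≤ ‖x - y‖
  hDo : MeasurableSet D
  hDf : volume D < ∞

lemma ObsGeom.sub {n : ℕ} {E D : Set (Euc n)} {δ R : ℝ} (h : ObsGeom E D δ R) : E ⊆ D := by
  intro x hx
  by_contra hc
  have := h.hd x hx x hc
  have := h.hδ
  simp at *; linarith

lemma obs_holder {α : Type*} [MeasurableSpace α] (μ : Measure α) {p : ℝ} (hp : 1 < p)
    {f : α → ℝ≥0∞} {h : α → ℝ} (hf : Measurable f) (hh : Measurable h) :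
    ∫⁻ x, f x * ‖h x‖ₑ ∂μ ≤ (∫⁻ x, f x ^ (p/(p-1)) ∂μ) ^ (1/(p/(p-1))) * eLpNorm' h p μ := by
  have hc : p.HolderConjugate (p/(p-1)) := Real.HolderConjugate.conjExponent hp
  have := ENNReal.lintegral_mul_le_Lp_mul_Lq μ hc.symm hf.aemeasurable hh.enorm.aemeasurable
  exact this

lemma obs_bound {n : ℕ} {s p Λ : ℝ} (hs0 : 0 < s) (hp : 1 < p) (hΛ : 1 ≤ Λ)
    {K : Euc n → Euc n → ℝ} (hK : IsKernel n s p Λ K) {D E : Set (Euc n)} {δ R : ℝ}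
    (hG : ObsGeom E D δ R) {w : Euc n → ℝ} (hw : Measurable w)
    (hw1 : MemLp w (ENNReal.ofReal p) (volume.restrict D))
    (hw2 : MemLp (obsPhi ((n:ℝ) + s * p) p w) (ENNReal.ofReal p)
      ((volume.restrict D).prod (volume.restrict D)))
    (hw3 : ∫⁻ y in Dᶜ, ENNReal.ofReal ((|w y| ^ (p-1) + 1) * (1 + ‖y‖) ^ (-((n:ℝ) + s * p))) < ∞) :
    ∃ C : ℝ≥0∞, C < ∞ ∧ ∀ ψ : Euc n → ℝ, Measurable ψ → (∀ x ∉ E, ψ x = 0) →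
      ∫⁻ q : Euc n × Euc n, ‖K q.1 q.2 * Lf p (w q.1) (w q.2) * (ψ q.1 - ψ q.2)‖ₑ
        ∂(volume.prod volume)
      ≤ C * (eLpNorm' ψ p volume + eLpNorm' (obsPhi ((n:ℝ) + s * p) p ψ) p (volume.prod volume)) := by
  obtain ⟨hKm, hKs, hK0, hKb⟩ := hK
  set N : ℝ := (n:ℝ) + s * p with hNdef
  have hN : 0 < N := by positivity
  have hΛ0 : 0 ≤ Λ := by linarith
  have hp0 : 0 < p - 1 := by linarith
  have p0 : ENNReal.ofReal p ≠ 0 := by simp; linarith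
  have pr : (ENNReal.ofReal p).toReal = p := ENNReal.toReal_ofReal (by linarith)
  have hqm : (p - 1) * (p/(p-1)) = p := by field_simp
  set M := ENNReal.ofReal (Λ * (1 + (1+R)/δ) ^ N * 2 ^ (p-1)) with hM
  set A1 := (∫⁻ q, (‖obsPhi N p w q‖ₑ ^ (p-1)) ^ (p/(p-1)) ∂((volume.restrict D).prod (volume.restrict D))) ^ (1/(p/(p-1))) with hA1
  set A2 := (∫⁻ x in D, (ENNReal.ofReal (|w x| ^ (p-1) + 1)) ^ (p/(p-1))) ^ (1/(p/(p-1))) with hA2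
  set B := ∫⁻ y in Dᶜ, ENNReal.ofReal ((|w y| ^ (p-1) + 1) * (1 + ‖y‖) ^ (-N)) with hB
  have hA1f : A1 < ∞ := by
    refine ENNReal.rpow_lt_top_of_nonneg (by positivity) ?_
    have := lintegral_rpow_enorm_lt_top_of_eLpNorm_lt_top p0 ENNReal.ofReal_ne_top hw2.2
    rw [pr] at this
    refine ne_of_lt (lt_of_eq_of_lt ?_ this)
    refine lintegral_congr fun q => ?_
    rw [← ENNReal.rpow_mul, hqm]
  have hA2f : A2 < ∞ := by
    refine ENNReal.rpow_lt_top_of_nonneg (by positivity) ?_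
    have := lintegral_rpow_enorm_lt_top_of_eLpNorm_lt_top p0 ENNReal.ofReal_ne_top hw1.2
    rw [pr] at this
    have hq1 : 1 ≤ p / (p-1) := by rw [le_div_iff₀ hp0]; linarith
    have hb : ∫⁻ x in D, 2 ^ (p/(p-1) - 1) * (‖w x‖ₑ ^ p + 1) < ∞ := by
      have h2t : (2:ℝ≥0∞) ^ (p/(p-1) - 1) < ∞ := ENNReal.rpow_lt_top_of_nonneg (by linarith) (by simp)
      rw [lintegral_const_mul' _ _ h2t.ne, lintegral_add_right _ measurable_const]
      refine ENNReal.mul_lt_top h2t (ENNReal.add_lt_top.2 ⟨this, ?_⟩)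
      simpa using hG.hDf
    refine ne_of_lt (lt_of_le_of_lt (lintegral_mono fun x => ?_) hb)
    have e : ENNReal.ofReal (|w x| ^ (p-1) + 1) = ‖w x‖ₑ ^ (p-1) + 1 := by
      rw [ENNReal.ofReal_add (by positivity) (by norm_num), Real.enorm_eq_ofReal_abs,
        ENNReal.ofReal_rpow_of_nonneg (abs_nonneg _) hp0.le]; simp
    rw [e]
    refine (ENNReal.rpow_add_le_mul_rpow_add_rpow _ _ hq1).trans ?_
    rw [← ENNReal.rpow_mul, hqm]; simp
  refine ⟨ENNReal.ofReal Λ * A1 + 2 * (M * (A2 * B)), ?_, ?_⟩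
  · refine ENNReal.add_lt_top.2 ⟨ENNReal.mul_lt_top (by simp) hA1f, ENNReal.mul_lt_top (by simp) ?_⟩
    exact ENNReal.mul_lt_top (by simp [M]) (ENNReal.mul_lt_top hA2f hw3)
  intro ψ hψ hψE
  have hΦw := obsPhi_meas N p hw
  have hΦψ := obsPhi_meas N p hψ
  set f1 : Euc n × Euc n → ℝ≥0∞ := (D ×ˢ D).indicator
    (fun q => ENNReal.ofReal Λ * (‖obsPhi N p w q‖ₑ ^ (p-1) * ‖obsPhi N p ψ q‖ₑ)) with hf1
  set a : Euc n → ℝ≥0∞ := D.indicator (fun x => ENNReal.ofReal (|w x| ^ (p-1) + 1) * ‖ψ x‖ₑ) with ha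
  set b : Euc n → ℝ≥0∞ := (Dᶜ).indicator
    (fun y => ENNReal.ofReal ((|w y| ^ (p-1) + 1) * (1 + ‖y‖) ^ (-N))) with hb
  have hf1m : Measurable f1 := by
    refine Measurable.indicator ?_ (hG.hDo.prod hG.hDo)
    fun_prop
  have ham : Measurable a := by
    refine Measurable.indicator ?_ hG.hDo
    fun_prop
  have hbm : Measurable b := by
    refine Measurable.indicator ?_ hG.hDo.compl
    fun_prop
  have cross : ∀ x y, x ∈ D → y ∉ D → K x y * ‖x - y‖ ^ N ≤ Λ → 
      ‖K x y * Lf p (w x) (w y) * (ψ x - ψ y)‖ₑ ≤ M * (a x * b y) := by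
    intro x y hx hy hxy
    have hy0 : ψ y = 0 := hψE y (fun h => hy (hG.sub h))
    rw [hy0, sub_zero]
    by_cases hxE : x ∈ E
    · have := obs_cross hN hp hG.hδ hG.hR (hK0 x y) hxy hΛ0 (hG.hd x hxE y hy) (hG.hE x hxE) w (ψ x)
      simpa only [ha, hb, Set.indicator_of_mem hx, Set.indicator_of_mem (show y ∈ Dᶜ from hy)] using this
    · rw [hψE x hxE]; simp
  have hpt : ∀ᵐ q : Euc n × Euc n ∂(volume.prod volume),
      ‖K q.1 q.2 * Lf p (w q.1) (w q.2) * (ψ q.1 - ψ q.2)‖ₑ ≤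
        f1 q + (M * (a q.1 * b q.2) + M * (b q.1 * a q.2)) := by
    filter_upwards [hKb] with q hq
    by_cases h1 : q.1 ∈ D <;> by_cases h2 : q.2 ∈ D
    · refine le_add_right ?_
      have hr : 0 < ‖q.1 - q.2‖ := by
        rcases (norm_nonneg (q.1 - q.2)).eq_or_lt with h | h
        · have := hq.1
          rw [← h, Real.zero_rpow hN.ne', mul_zero] at this
          have : 0 < Λ⁻¹ := by positivity
          linarith
        · exact h
      simp only [hf1]
      rw [Set.indicator_of_mem (show q ∈ D ×ˢ D from ⟨h1, h2⟩)]
      have := obs_P1 (K q.1 q.2) ‖q.1 - q.2‖ (w q.1 - w q.2) (ψ q.1 - ψ q.2) N p Λ hp hr hq.2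
      have hrp : 0 < ‖q.1 - q.2‖ ^ (N/p) := by positivity
      rw [Real.enorm_eq_ofReal_abs, Real.enorm_eq_ofReal_abs, Real.enorm_eq_ofReal_abs,
        ENNReal.ofReal_rpow_of_nonneg (abs_nonneg _) hp0.le, ← ENNReal.ofReal_mul (by positivity),
        ← ENNReal.ofReal_mul (by positivity)]
      refine ENNReal.ofReal_le_ofReal ?_
      rw [abs_mul, abs_mul, obs_abs_Lf _ _ _ hp, abs_of_nonneg (hK0 _ _)]
      simp only [obsPhi, abs_div, abs_of_pos hrp]
      rw [← mul_assoc]; exact this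
    · exact (cross _ _ h1 h2 hq.2).trans (le_add_left (le_add_right le_rfl))
    · have hq2 := hq.2
      rw [norm_sub_rev, hKs] at hq2
      have := cross _ _ h2 h1 hq2
      rw [hKs, obs_Lf_symm, ← neg_sub (ψ q.1) (ψ q.2), mul_neg, mul_neg, neg_mul, neg_neg] at this
      refine this.trans (le_add_left (le_add_left ?_))
      rw [mul_comm (a _)]
    · rw [hψE _ (fun h => h1 (hG.sub h)), hψE _ (fun h => h2 (hG.sub h))]; simp
  refine (lintegral_mono_ae hpt).trans ?_
  rw [lintegral_add_left hf1m, lintegral_add_left (by fun_prop), lintegral_const_mul _ (by fun_prop),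
    lintegral_const_mul _ (by fun_prop), lintegral_prod_mul ham.aemeasurable hbm.aemeasurable,
    lintegral_prod_mul hbm.aemeasurable ham.aemeasurable]
  have i1 : ∫⁻ q, f1 q ∂(volume.prod volume) ≤ ENNReal.ofReal Λ * (A1 * eLpNorm' (obsPhi N p ψ) p (volume.prod volume)) := by
    rw [hf1, lintegral_indicator (hG.hDo.prod hG.hDo), lintegral_const_mul _ (by fun_prop), ← Measure.prod_restrict]
    gcongr
    refine (obs_holder _ hp (by fun_prop) hΦψ).trans ?_
    rw [← hA1]
    gcongr
    all_goals exact Measure.restrict_le_self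
  have i2 : ∫⁻ x, a x ≤ A2 * eLpNorm' ψ p volume := by
    rw [ha, lintegral_indicator hG.hDo]
    refine (obs_holder _ hp (by fun_prop) hψ).trans ?_
    rw [← hA2]
    gcongr
    exact Measure.restrict_le_self
  have i3 : ∫⁻ y, b y = B := by
    rw [hb, lintegral_indicator hG.hDo.compl]
  rw [i3]
  set X := eLpNorm' ψ p volume
  set Y := eLpNorm' (obsPhi N p ψ) p (volume.prod volume)
  calc _ ≤ ENNReal.ofReal Λ * (A1 * Y) + (M * (A2 * X * B) + M * (B * (A2 * X))) := by gcongr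
    _ = ENNReal.ofReal Λ * A1 * Y + 2 * (M * (A2 * B)) * X := by ring
    _ ≤ (ENNReal.ofReal Λ * A1 + 2 * (M * (A2 * B))) * Y + (ENNReal.ofReal Λ * A1 + 2 * (M * (A2 * B))) * X := by
        gcongr
        · exact le_add_right le_rfl
        · exact le_add_left le_rfl
    _ = _ := by ring

lemma obs_weight {n : ℕ} {s p : ℝ} (hs0 : 0 < s) (hp : 1 < p) :
    Integrable (fun y : Euc n => (1 + ‖y‖) ^ (-((n:ℝ) + s * p))) volume := by
  refine integrable_one_add_norm ?_
  have : 0 < s * p := by positivity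
  simpa using this

lemma obs_tail {n : ℕ} {s p : ℝ} (hs0 : 0 < s) (hp : 1 < p) {w : Euc n → ℝ} (h : MemTail n s p w) :
    ∫⁻ y, ENNReal.ofReal ((|w y| ^ (p-1) + 1) * (1 + ‖y‖) ^ (-((n:ℝ) + s * p))) < ∞ := by
  obtain ⟨h1, h2, h3⟩ := h
  set N : ℝ := (n:ℝ) + s * p with hNdef
  have hN : 0 < N := by positivity
  have hm : AEMeasurable (fun y => |w y| ^ (p-1) * (1 + ‖y‖) ^ (-N)) volume := by
    have e : AEMeasurable (fun y => |w y| ^ (p-1)) volume := by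
      have := h1.norm.pow_const (p-1)
      simpa [Real.norm_eq_abs] using this
    exact e.mul (by fun_prop)
  have hi : Integrable (fun y => |w y| ^ (p-1) * (1 + ‖y‖) ^ (-N)) volume := by
    rw [← integrableOn_univ, ← Set.union_compl_self (ball (0 : Euc n) 1), integrableOn_union]
    constructor
    · refine (h2 0 1 one_pos).mono' hm.aestronglyMeasurable.restrict (Eventually.of_forall fun y => ?_)
      rw [Real.norm_of_nonneg (by positivity)]
      refine mul_le_of_le_one_right (by positivity) ?_
      exact Real.rpow_le_one_of_one_le_of_nonpos (by linarith [norm_nonneg y]) (by linarith)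
    · refine (h3 0 1 one_pos).mono' hm.aestronglyMeasurable.restrict ?_
      refine (ae_restrict_iff' measurableSet_ball.compl).2 (Eventually.of_forall fun y hy => ?_)
      rw [Real.norm_of_nonneg (by positivity)]
      have hy1 : 1 ≤ ‖y‖ := by simpa using hy
      refine mul_le_mul_of_nonneg_left ?_ (by positivity)
      rw [sub_zero]
      exact Real.rpow_le_rpow_of_nonpos (by linarith) (by linarith) (by linarith)
  have hi2 := hi.add (obs_weight (n := n) hs0 hp)
  have := hi2.lintegral_lt_top
  refine lt_of_eq_of_lt (lintegral_congr fun y => ?_) this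
  simp only [Pi.add_apply]; congr 1; ring

lemma obs_full {n : ℕ} {s p : ℝ} (hs0 : 0 < s) (hp : 1 < p)
    {D E : Set (Euc n)} {δ R : ℝ}
    (hG : ObsGeom E D δ R) {φ : Euc n → ℝ} (hφ : Measurable φ) (hφE : ∀ x ∉ E, φ x = 0)
    (h1 : MemLp φ (ENNReal.ofReal p) (volume.restrict D))
    (h2 : MemLp (obsPhi ((n:ℝ) + s * p) p φ) (ENNReal.ofReal p)
      ((volume.restrict D).prod (volume.restrict D))) :
    MemLp φ (ENNReal.ofReal p) volume ∧
    MemLp (obsPhi ((n:ℝ) + s * p) p φ) (ENNReal.ofReal p) (volume.prod volume) := by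
  set N : ℝ := (n:ℝ) + s * p with hNdef
  have hN : 0 < N := by positivity
  have p0 : ENNReal.ofReal p ≠ 0 := by simp; linarith
  have pr : (ENNReal.ofReal p).toReal = p := ENNReal.toReal_ofReal (by linarith)
  constructor
  · rw [← memLp_indicator_iff_restrict hG.hDo] at h1
    have e : D.indicator φ = φ := by
      funext x
      by_cases hx : x ∈ D
      · simp [hx]
      · simp [hx, hφE x (fun h => hx (hG.sub h))]
    rwa [e] at h1
  have hΦ := obsPhi_meas N p hφ
  refine ⟨hΦ.aestronglyMeasurable, ?_⟩
  rw [eLpNorm_lt_top_iff_lintegral_rpow_enorm_lt_top p0 ENNReal.ofReal_ne_top, pr]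
  have t1 := lintegral_rpow_enorm_lt_top_of_eLpNorm_lt_top p0 ENNReal.ofReal_ne_top h1.2
  have t2 := lintegral_rpow_enorm_lt_top_of_eLpNorm_lt_top p0 ENNReal.ofReal_ne_top h2.2
  have t3 := (obs_weight (n := n) hs0 hp).lintegral_lt_top
  rw [pr] at t1 t2
  set M := ENNReal.ofReal ((1 + (1+R)/δ) ^ N) with hM
  set f1 : Euc n × Euc n → ℝ≥0∞ := (D ×ˢ D).indicator (fun q => ‖obsPhi N p φ q‖ₑ ^ p) with hf1
  set a : Euc n → ℝ≥0∞ := D.indicator (fun x => ‖φ x‖ₑ ^ p) with ha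
  set b : Euc n → ℝ≥0∞ := fun y => ENNReal.ofReal ((1 + ‖y‖) ^ (-N)) with hb
  have hf1m : Measurable f1 := by
    refine Measurable.indicator ?_ (hG.hDo.prod hG.hDo)
    fun_prop
  have ham : Measurable a := by
    refine Measurable.indicator ?_ hG.hDo
    fun_prop
  have hbm : Measurable b := by
    fun_prop
  have cross : ∀ x y, x ∈ D → y ∉ D → ‖obsPhi N p φ (x, y)‖ₑ ^ p ≤ M * (a x * b y) := by
    intro x y hx hy
    have hy0 : φ y = 0 := hφE y (fun h => hy (hG.sub h))
    by_cases hxE : x ∈ E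
    · have hr := hG.hd x hxE y hy
      have hr0 : 0 < ‖x - y‖ := hG.hδ.trans_le hr
      have hy : ‖y‖ ≤ R + ‖x - y‖ := by
        have : ‖y‖ ≤ ‖x‖ + ‖x - y‖ := by
          have := norm_sub_le x (x - y)
          simpa using this
        linarith [hG.hE x hxE]
      have := obs_P3 ‖x - y‖ ‖y‖ N R δ hN hG.hδ hG.hR hr (norm_nonneg _) hy
      simp only [ha, hb, Set.indicator_of_mem hx, hM, obsPhi, hy0, sub_zero]
      rw [Real.enorm_eq_ofReal_abs, Real.enorm_eq_ofReal_abs,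
        ENNReal.ofReal_rpow_of_nonneg (abs_nonneg _) (by linarith),
        ENNReal.ofReal_rpow_of_nonneg (abs_nonneg _) (by linarith),
        ← ENNReal.ofReal_mul (by positivity), ← ENNReal.ofReal_mul (by have := hG.hδ; have := hG.hR; positivity)]
      refine ENNReal.ofReal_le_ofReal ?_
      rw [abs_div, abs_of_nonneg (a := ‖x - y‖ ^ (N/p)) (by positivity),
        Real.div_rpow (by positivity) (by positivity), ← Real.rpow_mul (by positivity),
        div_mul_cancel₀ _ (by linarith), div_eq_mul_inv]
      calc |φ x| ^ p * (‖x - y‖ ^ N)⁻¹ ≤ |φ x| ^ p * ((1 + (1+R)/δ) ^ N * (1 + ‖y‖) ^ (-N)) := by gcongr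
        _ = _ := by ring
    · simp only [obsPhi, hφE x hxE, hy0, sub_zero, zero_div, enorm_zero]
      rw [ENNReal.zero_rpow_of_pos (by linarith)]; exact zero_le
  have hpt : ∀ q : Euc n × Euc n,
      ‖obsPhi N p φ q‖ₑ ^ p ≤ f1 q + (M * (a q.1 * b q.2) + M * (b q.1 * a q.2)) := by
    intro q
    by_cases h1 : q.1 ∈ D <;> by_cases h2 : q.2 ∈ D
    · refine le_add_right ?_
      simp only [hf1]
      rw [Set.indicator_of_mem (show q ∈ D ×ˢ D from ⟨h1, h2⟩)]
    · exact (cross _ _ h1 h2).trans (le_add_left (le_add_right le_rfl))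
    · have := cross _ _ h2 h1
      have e : obsPhi N p φ (q.2, q.1) = - obsPhi N p φ q := by
        simp only [obsPhi]; rw [norm_sub_rev]; ring
      rw [e, enorm_neg] at this
      refine this.trans (le_add_left (le_add_left ?_))
      rw [mul_comm (a _)]
    · simp only [obsPhi]
      rw [hφE _ (fun h => h1 (hG.sub h)), hφE _ (fun h => h2 (hG.sub h))]
      simp only [sub_zero, zero_div, enorm_zero]
      rw [ENNReal.zero_rpow_of_pos (by linarith)]; exact zero_le
  refine (lintegral_mono hpt).trans_lt ?_
  rw [lintegral_add_left hf1m, lintegral_add_left (by fun_prop), lintegral_const_mul _ (by fun_prop),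
    lintegral_const_mul _ (by fun_prop), lintegral_prod_mul ham.aemeasurable hbm.aemeasurable,
    lintegral_prod_mul hbm.aemeasurable ham.aemeasurable]
  have i1 : ∫⁻ q, f1 q ∂(volume.prod volume) < ∞ := by
    rw [hf1, lintegral_indicator (hG.hDo.prod hG.hDo), ← Measure.prod_restrict]
    exact t2
  have i2 : ∫⁻ x, a x < ∞ := by
    rw [ha, lintegral_indicator hG.hDo]; exact t1
  refine ENNReal.add_lt_top.2 ⟨i1, ENNReal.add_lt_top.2 ⟨?_, ?_⟩⟩
  · exact ENNReal.mul_lt_top (by simp [M]) (ENNReal.mul_lt_top i2 t3)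
  · exact ENNReal.mul_lt_top (by simp [M]) (ENNReal.mul_lt_top t3 i2)

lemma obs_Lf_meas (p : ℝ) {α : Type*} [MeasurableSpace α] {f g : α → ℝ} (hf : Measurable f)
    (hg : Measurable g) : Measurable (fun x => Lf p (f x) (g x)) := by
  unfold Lf; fun_prop

lemma obs_norm_trans {n : ℕ} (p : ℝ) {φ : Euc n → ℝ} (hφ : Measurable φ) (z : Euc n) :
    eLpNorm' (fun x => φ (x - z)) p volume = eLpNorm' φ p volume := by
  unfold eLpNorm'
  congr 1
  exact lintegral_sub_right_eq_self (fun x => ‖φ x‖ₑ ^ p) z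

lemma obs_Phi_trans {n : ℕ} (N p : ℝ) {φ : Euc n → ℝ} (hφ : Measurable φ) (z : Euc n) :
    eLpNorm' (obsPhi N p (fun x => φ (x - z))) p (volume.prod volume) =
      eLpNorm' (obsPhi N p φ) p (volume.prod volume) := by
  unfold eLpNorm'
  congr 1
  have hmp : MeasurePreserving (fun q : Euc n × Euc n => (q.1 - z, q.2 - z))
      (volume.prod volume) (volume.prod volume) :=
    (measurePreserving_sub_right volume z).prod (measurePreserving_sub_right volume z)
  have hΦ := obsPhi_meas N p hφ
  rw [← hmp.lintegral_comp (f := fun q => ‖obsPhi N p φ q‖ₑ ^ p) (by fun_prop)]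
  refine lintegral_congr fun q => ?_
  simp [obsPhi]

lemma obs_moll {n : ℕ} {s p : ℝ} (hp : 1 < p)
    {K : Euc n → Euc n → ℝ} (hKm : Measurable (Function.uncurry K)) {Ω Ω'' : Set (Euc n)}
    (hΩb : Bornology.IsBounded Ω) {ε : ℝ} (hε : 0 < ε) (hΩε : cthickening ε Ω ⊆ Ω'')
    {v : Euc n → ℝ} (hv : Measurable v) {C : ℝ≥0∞} (hC : C < ∞)
    (hbd : ∀ ψ : Euc n → ℝ, Measurable ψ → (∀ x ∉ thickening ε Ω, ψ x = 0) →
      ∫⁻ q : Euc n × Euc n, ‖K q.1 q.2 * Lf p (v q.1) (v q.2) * (ψ q.1 - ψ q.2)‖ₑ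
        ∂(volume.prod volume)
      ≤ C * (eLpNorm' ψ p volume + eLpNorm' (obsPhi ((n:ℝ) + s * p) p ψ) p (volume.prod volume)))
    {φ : Euc n → ℝ} (hφ : Measurable φ) (hφ0 : ∀ x, 0 ≤ φ x) (hφΩ : ∀ x ∉ Ω, φ x = 0)
    (h1 : MemLp φ (ENNReal.ofReal p) volume)
    (h2 : MemLp (obsPhi ((n:ℝ) + s * p) p φ) (ENNReal.ofReal p) (volume.prod volume))
    (test : ∀ η : Euc n → ℝ, ContDiff ℝ (⊤ : ℕ∞) η → HasCompactSupport η → tsupport η ⊆ Ω'' →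
      (∀ x, 0 ≤ η x) → 0 ≤ ∫ x, ∫ y, K x y * Lf p (v x) (v y) * (η x - η y)) :
    0 ≤ ∫ q : Euc n × Euc n, K q.1 q.2 * Lf p (v q.1) (v q.2) * (φ q.1 - φ q.2)
      ∂(volume.prod volume) := by
  set N : ℝ := (n:ℝ) + s * p with hNdef
  have p0 : ENNReal.ofReal p ≠ 0 := by simp; linarith
  have pr : (ENNReal.ofReal p).toReal = p := ENNReal.toReal_ofReal (by linarith)
  have hp1 : 1 ≤ ENNReal.ofReal p := by simpa using hp.le
  have eL : ∀ {α : Type} [MeasurableSpace α] (μ : Measure α) (f : α → ℝ),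
      eLpNorm' f p μ = eLpNorm f (ENNReal.ofReal p) μ := by
    intro α _ μ f
    rw [eLpNorm_eq_eLpNorm' p0 ENNReal.ofReal_ne_top, pr]
  set Bd : Euc n × Euc n → ℝ := fun q => K q.1 q.2 * Lf p (v q.1) (v q.2) with hBd
  have hBdm : Measurable Bd :=
    (show Measurable (fun q : Euc n × Euc n => K q.1 q.2) from hKm).mul
      (obs_Lf_meas p (hv.comp measurable_fst) (hv.comp measurable_snd))
  set T : ℝ≥0∞ := C * (eLpNorm' φ p volume + eLpNorm' (obsPhi N p φ) p (volume.prod volume)) with hT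
  have hTf : T < ∞ := by
    refine ENNReal.mul_lt_top hC (ENNReal.add_lt_top.2 ⟨?_, ?_⟩)
    · rw [eL]; exact h1.2
    · rw [eL]; exact h2.2
  have hsupp : ∀ z : Euc n, ‖z‖ < ε → ∀ x ∉ thickening ε Ω, φ (x - z) = 0 := by
    intro z hz x hx
    refine hφΩ _ fun hc => hx ?_
    rw [mem_thickening_iff]
    exact ⟨x - z, hc, by simpa [dist_eq_norm] using hz⟩
  have htr : ∀ z : Euc n, Measurable (fun x => φ (x - z)) := fun z =>
    hφ.comp (measurable_id.sub_const z)
  have hbz : ∀ z : Euc n, ‖z‖ < ε →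
      ∫⁻ q : Euc n × Euc n, ‖Bd q * (φ (q.1 - z) - φ (q.2 - z))‖ₑ ∂(volume.prod volume) ≤ T := by
    intro z hz
    have := hbd (fun x => φ (x - z)) (htr z) (hsupp z hz)
    rw [obs_norm_trans p hφ, obs_Phi_trans N p hφ] at this
    exact this
  have hmz : ∀ z : Euc n, Measurable fun q : Euc n × Euc n => Bd q * (φ (q.1 - z) - φ (q.2 - z)) := by
    intro z
    exact hBdm.mul (((htr z).comp measurable_fst).sub ((htr z).comp measurable_snd))
  have hiz : ∀ z : Euc n, ‖z‖ < ε → 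
      Integrable (fun q : Euc n × Euc n => Bd q * (φ (q.1 - z) - φ (q.2 - z))) (volume.prod volume) := by
    intro z hz
    exact ⟨(hmz z).aestronglyMeasurable, (hbz z hz).trans_lt hTf⟩
  set G : Euc n → ℝ := fun z => ∫ q : Euc n × Euc n, Bd q * (φ (q.1 - z) - φ (q.2 - z)) ∂(volume.prod volume) with hGdef
  have hGc : Tendsto G (𝓝 0) (𝓝 (G 0)) := by
    rw [tendsto_iff_edist_tendsto_0]
    have c1 : Tendsto (fun z : Euc n => eLpNorm' (fun x => φ (x - z) - φ x) p volume) (𝓝 0) (𝓝 0) := by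
      have := (obs_trans_cont (V := Euc n) hp1 ENNReal.ofReal_ne_top h1).comp
        (show Tendsto (fun z : Euc n => -z) (𝓝 0) (𝓝 0) by simpa using (continuous_neg (G := Euc n)).tendsto 0)
      refine this.congr fun z => ?_
      rw [eL]
      simp only [Function.comp, vadd_eq_add, neg_add_eq_sub]
    have c2 : Tendsto (fun z : Euc n => eLpNorm' (obsPhi N p (fun x => φ (x - z) - φ x)) p
        (volume.prod volume)) (𝓝 0) (𝓝 0) := by
      have := (obs_trans_cont (V := Euc n) hp1 ENNReal.ofReal_ne_top h2).comp
        (show Tendsto (fun z : Euc n => -z) (𝓝 0) (𝓝 0) by simpa using (continuous_neg (G := Euc n)).tendsto 0)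
      refine this.congr fun z => ?_
      rw [eL]
      simp only [Function.comp]
      congr 1
      funext q
      have e1 : (-z +ᵥ q).1 = q.1 - z := by simp [neg_add_eq_sub]
      have e2 : (-z +ᵥ q).2 = q.2 - z := by simp [neg_add_eq_sub]
      simp only [obsPhi, e1, e2, sub_sub_sub_cancel_right]
      ring
    have c3 := ENNReal.Tendsto.const_mul (a := C) (c1.add c2) (Or.inr hC.ne)
    rw [add_zero, mul_zero] at c3
    refine tendsto_of_tendsto_of_tendsto_of_le_of_le' tendsto_const_nhds c3
      (Eventually.of_forall fun _ => zero_le) ?_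
    filter_upwards [Metric.ball_mem_nhds (0 : Euc n) hε] with z hz
    have hz' : ‖z‖ < ε := by simpa using hz
    rw [edist_eq_enorm_sub, hGdef]
    simp only
    rw [← integral_sub (hiz z hz') (hiz 0 (by simpa using hε))]
    refine (enorm_integral_le_lintegral_enorm _).trans ?_
    have := hbd (fun x => φ (x - z) - φ x) ((htr z).sub hφ) (fun x hx => by
      have h0 := hsupp 0 (by simpa using hε) x hx
      rw [sub_zero] at h0
      rw [hsupp z hz' x hx, h0, sub_zero])
    refine le_trans (le_of_eq (lintegral_congr fun q => ?_)) this
    congr 1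
    simp only [sub_zero, hBd]; ring
  have hG0 : G 0 = ∫ q : Euc n × Euc n, K q.1 q.2 * Lf p (v q.1) (v q.2) * (φ q.1 - φ q.2)
      ∂(volume.prod volume) := by
    simp only [hGdef, hBd, sub_zero]
  rw [← hG0]
  by_contra hneg
  push Not at hneg
  have hev : ∀ᶠ z in 𝓝 (0 : Euc n), G z < G 0 / 2 :=
    hGc.eventually (gt_mem_nhds (by linarith))
  obtain ⟨r, hr, hrG⟩ := Metric.eventually_nhds_iff.1 hev
  set e := min r ε with he
  have hepos : 0 < e := lt_min hr hε
  let ρ : ContDiffBump (0 : Euc n) := ⟨e/2, e, by positivity, by linarith⟩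
  have hρs : ∀ z : Euc n, e ≤ ‖z‖ → ρ z = 0 := fun z hz =>
    ρ.zero_of_le_dist (by simpa [ρ] using hz)
  have hρc : Continuous ρ := ρ.continuous
  have hρi : Integrable (fun z => ρ z) volume := ρ.integrable
  have hφi : Integrable φ volume := by
    obtain ⟨R, hR⟩ := hΩb.subset_ball (0 : Euc n)
    have i1 : IntegrableOn φ (ball 0 R) volume := by
      haveI : IsFiniteMeasure (volume.restrict (ball (0 : Euc n) R)) := ⟨by simpa using measure_ball_lt_top⟩
      exact (h1.restrict _).integrable hp1
    rwa [integrableOn_iff_integrable_of_support_subset] at i1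
    intro x hx
    by_contra hc
    exact hx (hφΩ x (fun h => hc (hR h)))
  have hρφ : ∀ x, Integrable (fun z => ρ z * φ (x - z)) volume := by
    intro x
    refine (hφi.comp_sub_left x).bdd_mul (c := 1) hρc.aestronglyMeasurable (Eventually.of_forall fun z => ?_)
    rw [Real.norm_of_nonneg ρ.nonneg]; exact ρ.le_one
  set η : Euc n → ℝ := fun x => ∫ z, ρ z * φ (x - z) with hη
  have hη_smooth : ContDiff ℝ (⊤ : ℕ∞) η := by
    have := ρ.hasCompactSupport.contDiff_convolution_left (n := ⊤) (ContinuousLinearMap.lsmul ℝ ℝ) (μ := volume)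
      ρ.contDiff hφi.locallyIntegrable
    exact this
  have hη0 : ∀ x ∉ thickening e Ω, η x = 0 := by
    intro x hx
    simp only [hη]
    rw [← integral_zero (Euc n) ℝ]
    congr 1; funext z
    by_cases hz : ‖z‖ < e
    · have : φ (x - z) = 0 := by
        refine hφΩ _ fun hc => hx ?_
        rw [mem_thickening_iff]
        exact ⟨x - z, hc, by simpa [dist_eq_norm] using hz⟩
      rw [this, mul_zero]
    · rw [hρs z (not_lt.1 hz), zero_mul]
  have hηt : tsupport η ⊆ cthickening e Ω := by
    refine closure_minimal ?_ isClosed_cthickening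
    intro x hx
    by_contra hc
    exact hx (hη0 x fun h => hc (thickening_subset_cthickening _ _ h))
  have hηc : HasCompactSupport η :=
    IsCompact.of_isClosed_subset (isCompact_of_isClosed_isBounded isClosed_cthickening hΩb.cthickening)
      (isClosed_tsupport _) hηt
  have hηΩ : tsupport η ⊆ Ω'' :=
    hηt.trans ((cthickening_mono (min_le_right _ _) _).trans hΩε)
  have hηn : ∀ x, 0 ≤ η x := fun x => integral_nonneg fun z => mul_nonneg ρ.nonneg (hφ0 _)
  have htest := test η hη_smooth hηc hηΩ hηn
  have hF : Integrable (Function.uncurry fun (q : Euc n × Euc n) (z : Euc n) =>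
      ρ z * (Bd q * (φ (q.1 - z) - φ (q.2 - z)))) ((volume.prod volume).prod volume) := by
    have hm : Measurable (Function.uncurry fun (q : Euc n × Euc n) (z : Euc n) =>
      ρ z * (Bd q * (φ (q.1 - z) - φ (q.2 - z)))) := by
      have := hρc.measurable
      simp only [Function.uncurry_def]
      fun_prop
    refine ⟨hm.aestronglyMeasurable, ?_⟩
    show ∫⁻ _, _ ∂_ < ∞
    rw [lintegral_prod_symm _ hm.enorm.aemeasurable]
    have : ∫⁻ z, ‖ρ z‖ₑ * T < ∞ := by
      rw [lintegral_mul_const _ hρc.measurable.enorm]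
      exact ENNReal.mul_lt_top hρi.2 hTf
    refine lt_of_le_of_lt (lintegral_mono fun z => ?_) this
    simp only [Function.uncurry, enorm_mul (ρ z)]
    rw [lintegral_const_mul _ (hmz z).enorm]
    by_cases hz : ‖z‖ < ε
    · gcongr; exact hbz z hz
    · rw [hρs z ((min_le_right _ _).trans (not_lt.1 hz))]; simp
  have hinner : ∀ q : Euc n × Euc n, ∫ z, ρ z * (Bd q * (φ (q.1 - z) - φ (q.2 - z))) =
      Bd q * (η q.1 - η q.2) := by
    intro q
    simp only [hη]
    rw [← integral_sub (hρφ _) (hρφ _), ← integral_const_mul]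
    congr 1; funext z; ring
  have hiη : Integrable (fun q : Euc n × Euc n => Bd q * (η q.1 - η q.2)) (volume.prod volume) := by
    have := hF.integral_prod_left
    refine this.congr (Eventually.of_forall fun q => ?_)
    exact hinner q
  have hswap := integral_integral_swap hF
  simp only [hinner] at hswap
  have hpr := integral_prod _ hiη
  simp only [hBd] at hpr
  simp only [hBd] at hswap
  rw [hpr] at hswap
  rw [hswap] at htest
  have hGi : Integrable (fun z => ρ z * G z) volume := by
    have := hF.integral_prod_right
    refine this.congr (Eventually.of_forall fun z => ?_)
    simp only [Function.uncurry]
    rw [integral_const_mul]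
  have heq : ∫ z, ∫ q : Euc n × Euc n, ρ z * (K q.1 q.2 * Lf p (v q.1) (v q.2) * (φ (q.1 - z) - φ (q.2 - z))) ∂(volume.prod volume) = ∫ z, ρ z * G z := by
    congr 1; funext z
    rw [integral_const_mul]
  rw [heq] at htest
  have hle : ∫ z, ρ z * G z ≤ ∫ z, ρ z * (G 0 / 2) := by
    refine integral_mono hGi (hρi.mul_const _) fun z => ?_
    by_cases hz : ‖z‖ < e
    · refine mul_le_mul_of_nonneg_left ?_ ρ.nonneg
      exact (hrG (by simpa using hz.trans_le (min_le_left _ _))).le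
    · simp only [hρs z (not_lt.1 hz), zero_mul]; exact le_rfl
  rw [integral_mul_const] at hle
  have hpos : 0 < ∫ z, ρ z := ρ.integral_pos
  nlinarith

lemma obsPhi_congr {n : ℕ} (N p : ℝ) {w w' : Euc n → ℝ} {μ : Measure (Euc n)} [SFinite μ]
    (h : w =ᵐ[μ] w') : obsPhi N p w =ᵐ[μ.prod μ] obsPhi N p w' := by
  have a1 := Measure.quasiMeasurePreserving_fst (μ := μ) (ν := μ) |>.ae h
  have a2 := Measure.quasiMeasurePreserving_snd (μ := μ) (ν := μ) |>.ae h
  filter_upwards [a1, a2] with q h1 h2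
  simp only [obsPhi, h1, h2]

lemma obs_Aop_congr {n : ℕ} (p : ℝ) (Ω Ω' : Set (Euc n)) (g : Euc n → ℝ)
    (K : Euc n → Euc n → ℝ) {u u' ψ φ : Euc n → ℝ} (hu : u =ᵐ[volume] u') 
    (hψ : ψ =ᵐ[volume] fun x => - φ x) :
    Aop n p Ω Ω' g K u ψ = - Aop n p Ω Ω' g K u' φ := by
  unfold Aop
  have e1 : (∫ x in Ω', ∫ y in Ω', Lf p (u x) (u y) * (ψ x - ψ y) * K x y) = 
      - ∫ x in Ω', ∫ y in Ω', Lf p (u' x) (u' y) * (φ x - φ y) * K x y := by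
    rw [← integral_neg]
    refine integral_congr_ae ?_
    filter_upwards [ae_restrict_of_ae hu, ae_restrict_of_ae hψ] with x h1 h2
    rw [← integral_neg]
    refine integral_congr_ae ?_
    filter_upwards [ae_restrict_of_ae hu, ae_restrict_of_ae hψ] with y h3 h4
    rw [h1, h2, h3, h4]; ring
  have e2 : (∫ y in Ω'ᶜ, ∫ x in Ω, Lf p (u x) (g y) * ψ x * K x y) =
      - ∫ y in Ω'ᶜ, ∫ x in Ω, Lf p (u' x) (g y) * φ x * K x y := by
    rw [← integral_neg]
    refine integral_congr_ae (Eventually.of_forall fun y => ?_)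
    simp only
    rw [← integral_neg]
    refine integral_congr_ae ?_
    filter_upwards [ae_restrict_of_ae hu, ae_restrict_of_ae hψ] with x h3 h4
    rw [h3, h4]; ring
  rw [e1, e2]; ring

lemma obs_Aop_eq {n : ℕ} (p : ℝ) {Ω Ω' : Set (Euc n)} (hΩ' : MeasurableSet Ω')
    (hsub : Ω ⊆ Ω') (g : Euc n → ℝ) {K : Euc n → Euc n → ℝ} (hKs : ∀ x y, K x y = K y x)
    {u φ : Euc n → ℝ} (hug : ∀ᵐ x ∂(volume : Measure (Euc n)), x ∉ Ω → u x = g x)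
    (hφ : ∀ x ∉ Ω, φ x = 0)
    (hi : Integrable (fun q : Euc n × Euc n => K q.1 q.2 * Lf p (u q.1) (u q.2) * (φ q.1 - φ q.2))
      (volume.prod volume)) :
    Aop n p Ω Ω' g K u φ =
      ∫ q : Euc n × Euc n, K q.1 q.2 * Lf p (u q.1) (u q.2) * (φ q.1 - φ q.2) ∂(volume.prod volume) := by
  set f : Euc n × Euc n → ℝ := fun q => K q.1 q.2 * Lf p (u q.1) (u q.2) * (φ q.1 - φ q.2) with hf
  have hsym : ∀ q : Euc n × Euc n, f q.swap = f q := by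
    intro q
    simp only [hf, Prod.fst_swap, Prod.snd_swap]
    rw [hKs, obs_Lf_symm]; ring
  have m1 : MeasurableSet (Ω' ×ˢ (Set.univ : Set (Euc n))) := hΩ'.prod MeasurableSet.univ
  have split : ∫ q, f q ∂(volume.prod volume) =
      (∫ q in Ω' ×ˢ Ω', f q ∂(volume.prod volume)) + (∫ q in Ω' ×ˢ Ω'ᶜ, f q ∂(volume.prod volume))
      + ((∫ q in Ω'ᶜ ×ˢ Ω', f q ∂(volume.prod volume)) + ∫ q in Ω'ᶜ ×ˢ Ω'ᶜ, f q ∂(volume.prod volume)) := by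
    rw [← setIntegral_union (Set.Disjoint.set_prod_right disjoint_compl_right _ _) (hΩ'.prod hΩ'.compl) hi.integrableOn hi.integrableOn,
      ← setIntegral_union (Set.Disjoint.set_prod_right disjoint_compl_right _ _) (hΩ'.compl.prod hΩ'.compl) hi.integrableOn hi.integrableOn,
      ← Set.prod_union, ← Set.prod_union, Set.union_compl_self,
      ← setIntegral_union (Set.Disjoint.set_prod_left disjoint_compl_right _ _) (hΩ'.compl.prod MeasurableSet.univ) hi.integrableOn hi.integrableOn,
      ← Set.union_prod, Set.union_compl_self, Set.univ_prod_univ, setIntegral_univ]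
  have z4 : ∫ q in Ω'ᶜ ×ˢ Ω'ᶜ, f q ∂(volume.prod volume) = 0 := by
    refine setIntegral_eq_zero_of_forall_eq_zero fun q hq => ?_
    simp only [hf]
    rw [hφ _ (fun h => hq.1 (hsub h)), hφ _ (fun h => hq.2 (hsub h))]; simp
  have e23 : ∫ q in Ω' ×ˢ Ω'ᶜ, f q ∂(volume.prod volume) = ∫ q in Ω'ᶜ ×ˢ Ω', f q ∂(volume.prod volume) := by
    rw [← setIntegral_prod_swap]
    simp only [hsym]
  have e1 : ∫ q in Ω' ×ˢ Ω', f q ∂(volume.prod volume) = 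
      ∫ x in Ω', ∫ y in Ω', Lf p (u x) (u y) * (φ x - φ y) * K x y := by
    rw [setIntegral_prod _ hi.integrableOn]
    congr 1; funext x; congr 1; funext y
    simp only [hf]; ring
  have e3 : ∫ q in Ω'ᶜ ×ˢ Ω', f q ∂(volume.prod volume) =
      ∫ y in Ω'ᶜ, ∫ x in Ω, Lf p (u x) (g y) * φ x * K x y := by
    rw [setIntegral_prod _ hi.integrableOn]
    refine integral_congr_ae ?_
    filter_upwards [ae_restrict_of_ae hug, ae_restrict_mem hΩ'.compl] with y hy hyc
    have hyΩ : y ∉ Ω := fun h => hyc (hsub h)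
    rw [← setIntegral_eq_of_subset_of_forall_sdiff_eq_zero hΩ' hsub]
    · congr 1; funext x
      rw [← hsym (y, x)]
      simp only [hf, Prod.swap]
      rw [hy hyΩ, hφ y hyΩ]; ring
    · intro x hx
      simp [hφ x hx.2]
  rw [split, z4, e23, e1, e3]
  unfold Aop; ring

/-- Proposition 3.5: the solution to the obstacle problem is the smallest supersolution
above the obstacle: if `v` is a weak supersolution in `Ω'' ⊇ closure Ω` and
`min{u,v} ∈ K_{g,h}(Ω,Ω')`, then `u ≤ v` a.e. -/
theorem obstacle_solution_smallest_supersolution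
    (n : ℕ) (s p Λ : ℝ) (hn : 1 ≤ n) (hs0 : 0 < s) (hs1 : s < 1) (hp : 1 < p)
    (hΛ : 1 ≤ Λ) (K : Euc n → Euc n → ℝ) (hK : IsKernel n s p Λ K)
    (Ω Ω' : Set (Euc n)) (hΩo : IsOpen Ω) (hΩ'o : IsOpen Ω')
    (hΩb : Bornology.IsBounded Ω) (hΩ'b : Bornology.IsBounded Ω') (hΩΩ' : closure Ω ⊆ Ω')
    (g : Euc n → ℝ) (h : Euc n → EReal)
    (hg : MemW n s p Ω' g) (hgt : MemTail n s p g)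
    (hne : (obstacleSet n s p Ω Ω' g h).Nonempty)
    (Ω'' : Set (Euc n)) (hΩ''o : IsOpen Ω'') (hΩΩ'' : closure Ω ⊆ Ω'') (hΩ''Ω' : Ω'' ⊆ Ω')
    (u v : Euc n → ℝ) (hu : SolvesObstacle n s p Ω Ω' g h K u)
    (hv : IsWeakSupersol n s p K Ω'' v)
    (hmin : (fun x => min (u x) (v x)) ∈ obstacleSet n s p Ω Ω' g h) :
    ∀ᵐ x ∂(volume : Measure (Euc n)), u x ≤ v x := by
  obtain ⟨⟨huW, huh, hug⟩, huA⟩ := hu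
  obtain ⟨hvW, hvT, hvtest⟩ := hv
  have huAm := huA _ hmin
  obtain ⟨hmW, hmh, hmg⟩ := hmin
  have hKs := hK.2.1
  have hK0 := hK.2.2.1
  have hKb := hK.2.2.2
  set N : ℝ := (n:ℝ) + s * p with hNdef
  have hN : 0 < N := by positivity
  have hsub : Ω ⊆ Ω' := subset_closure.trans hΩΩ'
  have hum : AEMeasurable u volume := by
    have h2 : AEMeasurable u (volume.restrict Ω'ᶜ) := by
      refine (hgt.1.restrict (s := Ω'ᶜ)).congr ?_
      filter_upwards [ae_restrict_of_ae hug, ae_restrict_mem hΩ'o.measurableSet.compl] with x h1 h2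
      exact (h1 fun h => h2 (hsub h)).symm
    have := aemeasurable_union_iff.2 ⟨huW.1, h2⟩
    rwa [Set.union_compl_self, Measure.restrict_univ] at this
  obtain ⟨u', hu'm, huu'⟩ := hum
  obtain ⟨v', hv'm, hvv'⟩ := hvT.1
  set φ : Euc n → ℝ := Ω.indicator (fun x => max (u' x - v' x) 0) with hφdef
  have hφm : Measurable φ := by
    refine Measurable.indicator ?_ hΩo.measurableSet
    fun_prop
  have hφ0 : ∀ x, 0 ≤ φ x := fun x => Set.indicator_nonneg (fun x _ => le_max_right _ _) x
  have hφΩ : ∀ x ∉ Ω, φ x = 0 := fun x hx => Set.indicator_of_notMem hx _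
  have hφmax : ∀ᵐ x ∂(volume : Measure (Euc n)), φ x = max (u' x - v' x) 0 := by
    filter_upwards [huu', hvv', hug, hmg] with x h1 h2 h3 h4
    by_cases hx : x ∈ Ω
    · exact Set.indicator_of_mem hx _
    · rw [hφΩ x hx, ← h1, ← h2]
      have h5 := h4 hx
      rw [← h3 hx] at h5
      have : u x ≤ v x := by rw [← h5]; exact min_le_right _ _
      rw [max_eq_right (by linarith)]
  have hφmin : (fun x => u x - min (u x) (v x)) =ᵐ[volume] φ := by
    filter_upwards [hφmax, huu', hvv'] with x h0 h1 h2
    rw [h0, ← h1, ← h2]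
    rcases le_total (u x) (v x) with h | h
    · rw [min_eq_left h, max_eq_right (by linarith)]; ring
    · rw [min_eq_right h, max_eq_left (by linarith)]
  have hcpt : IsCompact (closure Ω) := hΩb.isCompact_closure
  obtain ⟨d, hd, hdΩ⟩ := hcpt.exists_cthickening_subset_open hΩ''o hΩΩ''
  rw [cthickening_closure] at hdΩ
  set D := thickening d Ω with hDdef
  have hDb : Bornology.IsBounded D := hΩb.thickening
  have hDcl : closure D ⊆ Ω'' := (closure_thickening_subset_cthickening _ _).trans hdΩ
  obtain ⟨R, hR⟩ := hDb.subset_ball (0 : Euc n)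
  have hDR : ∀ x ∈ D, ‖x‖ ≤ max R 0 := fun x hx =>
    le_trans (mem_ball_zero_iff.1 (hR hx)).le (le_max_left _ _)
  have hΩD : Ω ⊆ D := self_subset_thickening hd _
  have hDΩ' : D ⊆ Ω' := (thickening_subset_cthickening _ _).trans (hdΩ.trans hΩ''Ω')
  have G1 : ObsGeom Ω Ω' d (max R 0) := by
    refine ⟨hd, le_max_right _ _, fun x hx => hDR x (hΩD hx), ?_, hΩ'o.measurableSet, hΩ'b.measure_lt_top⟩
    intro x hx y hy
    by_contra hc
    refine hy (hDΩ' (mem_thickening_iff.2 ⟨x, hx, ?_⟩))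
    rw [dist_comm, dist_eq_norm]; exact not_le.1 hc
  have G2 : ObsGeom (thickening (d/2) Ω) D (d/2) (max R 0) := by
    refine ⟨by positivity, le_max_right _ _, fun x hx => hDR x (thickening_mono (by linarith) _ hx), ?_,
      isOpen_thickening.measurableSet, hDb.measure_lt_top⟩
    intro x hx y hy
    by_contra hc
    obtain ⟨t, ht, hxt⟩ := mem_thickening_iff.1 hx
    refine hy (mem_thickening_iff.2 ⟨t, ht, ?_⟩)
    have := dist_triangle y x t
    have h3 : dist y x < d/2 := by rw [dist_comm, dist_eq_norm]; exact not_le.1 hc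
    linarith
  obtain ⟨uL, uP⟩ := obs_memW hp huW
  obtain ⟨mL, mP⟩ := obs_memW hp hmW
  have hφL : MemLp φ (ENNReal.ofReal p) (volume.restrict Ω') :=
    (uL.sub mL).ae_eq (ae_restrict_of_ae hφmin)
  have hφP : MemLp (obsPhi N p φ) (ENNReal.ofReal p) ((volume.restrict Ω').prod (volume.restrict Ω')) := by
    refine (uP.sub mP).ae_eq ?_
    refine EventuallyEq.trans ?_ (obsPhi_congr N p (ae_restrict_of_ae hφmin))
    refine Eventually.of_forall fun q => ?_
    simp only [obsPhi, Pi.sub_apply]; ring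
  obtain ⟨φL, φP⟩ := obs_full hs0 hp G1 hφm hφΩ hφL hφP
  have u'L : MemLp u' (ENNReal.ofReal p) (volume.restrict Ω') := uL.ae_eq (ae_restrict_of_ae huu')
  have u'P := uP.ae_eq (obsPhi_congr N p (ae_restrict_of_ae huu'))
  have u'T : ∫⁻ y in Ω'ᶜ, ENNReal.ofReal ((|u' y| ^ (p-1) + 1) * (1 + ‖y‖) ^ (-N)) < ∞ := by
    refine lt_of_le_of_lt (le_trans (le_of_eq (lintegral_congr_ae ?_)) (setLIntegral_le_lintegral Ω'ᶜ _)) (obs_tail hs0 hp hgt)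
    filter_upwards [ae_restrict_of_ae hug, ae_restrict_of_ae huu',
      ae_restrict_mem hΩ'o.measurableSet.compl] with x h1 h2 h3
    rw [← h2, h1 fun h => h3 (hsub h)]
  obtain ⟨Cu, hCu, hbu⟩ := obs_bound hs0 hp hΛ hK G1 hu'm u'L u'P u'T
  obtain ⟨vL, vP⟩ := obs_memW hp (hvW D isOpen_thickening hDb hDcl)
  have v'L : MemLp v' (ENNReal.ofReal p) (volume.restrict D) := vL.ae_eq (ae_restrict_of_ae hvv')
  have v'P := vP.ae_eq (obsPhi_congr N p (ae_restrict_of_ae hvv'))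
  have v'T : ∫⁻ y in Dᶜ, ENNReal.ofReal ((|v' y| ^ (p-1) + 1) * (1 + ‖y‖) ^ (-N)) < ∞ := by
    refine lt_of_le_of_lt (le_trans (le_of_eq (lintegral_congr_ae ?_)) (setLIntegral_le_lintegral Dᶜ _)) (obs_tail hs0 hp hvT)
    filter_upwards [ae_restrict_of_ae hvv'] with x h2
    rw [← h2]
  obtain ⟨Cv, hCv, hbv⟩ := obs_bound hs0 hp hΛ hK G2 hv'm v'L v'P v'T
  have p0 : ENNReal.ofReal p ≠ 0 := by simp; linarith
  have pr : (ENNReal.ofReal p).toReal = p := ENNReal.toReal_ofReal (by linarith)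
  have nf : eLpNorm' φ p volume + eLpNorm' (obsPhi N p φ) p (volume.prod volume) < ∞ := by
    have a1 := φL.2
    have a2 := φP.2
    rw [eLpNorm_eq_eLpNorm' p0 ENNReal.ofReal_ne_top, pr] at a1 a2
    exact ENNReal.add_lt_top.2 ⟨a1, a2⟩
  have hmeas : ∀ w : Euc n → ℝ, Measurable w →
      Measurable (fun q : Euc n × Euc n => K q.1 q.2 * Lf p (w q.1) (w q.2) * (φ q.1 - φ q.2)) := by
    intro w hw
    exact ((show Measurable (fun q : Euc n × Euc n => K q.1 q.2) from hK.1).mul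
      (obs_Lf_meas p (hw.comp measurable_fst) (hw.comp measurable_snd))).mul
      ((hφm.comp measurable_fst).sub (hφm.comp measurable_snd))
  have hiu : Integrable (fun q : Euc n × Euc n => K q.1 q.2 * Lf p (u' q.1) (u' q.2) * (φ q.1 - φ q.2))
      (volume.prod volume) :=
    ⟨(hmeas u' hu'm).aestronglyMeasurable, (hbu φ hφm hφΩ).trans_lt (ENNReal.mul_lt_top hCu nf)⟩
  have hiv : Integrable (fun q : Euc n × Euc n => K q.1 q.2 * Lf p (v' q.1) (v' q.2) * (φ q.1 - φ q.2))
      (volume.prod volume) :=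
    ⟨(hmeas v' hv'm).aestronglyMeasurable, (hbv φ hφm
      (fun x hx => hφΩ x fun h => hx (self_subset_thickening (by positivity) _ h))).trans_lt
        (ENNReal.mul_lt_top hCv nf)⟩
  have I1 : ∫ q : Euc n × Euc n, K q.1 q.2 * Lf p (u' q.1) (u' q.2) * (φ q.1 - φ q.2)
      ∂(volume.prod volume) ≤ 0 := by
    have hug' : ∀ᵐ x ∂(volume : Measure (Euc n)), x ∉ Ω → u' x = g x := by
      filter_upwards [hug, huu'] with x h1 h2 h3
      rw [← h2, h1 h3]
    rw [← obs_Aop_eq p hΩ'o.measurableSet hsub g hKs hug' hφΩ hiu]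
    have := obs_Aop_congr p Ω Ω' g K (ψ := fun x => min (u x) (v x) - u x) (φ := φ) huu' (by
      filter_upwards [hφmin] with x hx
      rw [← hx]; ring)
    rw [this] at huAm
    linarith
  have I2 : 0 ≤ ∫ q : Euc n × Euc n, K q.1 q.2 * Lf p (v' q.1) (v' q.2) * (φ q.1 - φ q.2)
      ∂(volume.prod volume) := by
    refine obs_moll hp hK.1 hΩb (ε := d/2) (by positivity)
      ((cthickening_mono (by linarith) _).trans hdΩ) hv'm hCv hbv hφm hφ0 hφΩ φL φP ?_
    intro η h1 h2 h3 h4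
    have := hvtest η h1 h2 h3 h4
    refine this.trans (le_of_eq (integral_congr_ae ?_))
    filter_upwards [hvv'] with x hx
    refine integral_congr_ae ?_
    filter_upwards [hvv'] with y hy
    rw [hx, hy]
  set J : Euc n × Euc n → ℝ := fun q =>
    K q.1 q.2 * Lf p (u' q.1) (u' q.2) * (φ q.1 - φ q.2) -
    K q.1 q.2 * Lf p (v' q.1) (v' q.2) * (φ q.1 - φ q.2) with hJ
  have a1 := Measure.quasiMeasurePreserving_fst (μ := (volume : Measure (Euc n)))
    (ν := (volume : Measure (Euc n))) |>.ae hφmax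
  have a2 := Measure.quasiMeasurePreserving_snd (μ := (volume : Measure (Euc n)))
    (ν := (volume : Measure (Euc n))) |>.ae hφmax
  have key : ∀ a b c e : ℝ, max (a - c) 0 < max (b - e) 0 → Lf p a b < Lf p c e := by
    intro a b c e hlt
    refine obs_Lf_mono p _ _ _ _ hp ?_
    have h1 : a - c ≤ max (a - c) 0 := le_max_left _ _
    have h2 : 0 ≤ max (a - c) 0 := le_max_right _ _
    have h3 : max (b - e) 0 = b - e := by
      rcases max_choice (b - e) 0 with h | h
      · exact h
      · linarith
    linarith
  have hJ0 : 0 ≤ᵐ[volume.prod volume] J := by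
    filter_upwards [a1, a2] with q h1 h2
    simp only [hJ, Pi.zero_apply]
    have hk := hK0 q.1 q.2
    rcases lt_trichotomy (φ q.1) (φ q.2) with h | h | h
    · have h' := h
      rw [h1, h2] at h'
      have := key _ _ _ _ h'
      have : 0 ≤ K q.1 q.2 * ((Lf p (v' q.1) (v' q.2) - Lf p (u' q.1) (u' q.2)) * (φ q.2 - φ q.1)) :=
        mul_nonneg hk (mul_nonneg (by linarith) (by linarith))
      linarith
    · rw [h]; simp
    · have h' := h
      rw [h1, h2] at h'
      have := key _ _ _ _ h'
      rw [obs_Lf_symm p (u' q.2), obs_Lf_symm p (v' q.2)] at this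
      have : 0 ≤ K q.1 q.2 * ((Lf p (u' q.1) (u' q.2) - Lf p (v' q.1) (v' q.2)) * (φ q.1 - φ q.2)) :=
        mul_nonneg hk (mul_nonneg (by linarith) (by linarith))
      linarith
  have hJi : Integrable J (volume.prod volume) := hiu.sub hiv
  have hJz : ∫ q, J q ∂(volume.prod volume) = 0 := by
    refine le_antisymm ?_ (integral_nonneg_of_ae hJ0)
    simp only [hJ]
    rw [integral_sub hiu hiv]; linarith
  have hJae := (integral_eq_zero_iff_of_nonneg_ae hJ0 hJi).1 hJz
  have hKb' : ∀ᵐ q : Euc n × Euc n ∂(volume.prod volume), 0 < K q.1 q.2 := by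
    have hKb2 : ∀ᵐ z : Euc n × Euc n ∂(volume.prod volume),
      Λ⁻¹ ≤ K z.1 z.2 * ‖z.1 - z.2‖ ^ N ∧ K z.1 z.2 * ‖z.1 - z.2‖ ^ N ≤ Λ := hKb
    filter_upwards [hKb2] with q hq
    rcases (hK0 q.1 q.2).eq_or_lt with h | h
    · have h1 := hq.1
      rw [← h, zero_mul] at h1
      have : 0 < Λ⁻¹ := by positivity
      linarith
    · exact h
  have hconst : ∀ᵐ q : Euc n × Euc n ∂(volume.prod volume), φ q.1 = φ q.2 := by
    filter_upwards [a1, a2, hJae, hKb'] with q h1 h2 h3 hk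
    simp only [hJ, Pi.zero_apply] at h3
    rcases lt_trichotomy (φ q.1) (φ q.2) with h | h | h
    · have h' := h
      rw [h1, h2] at h'
      have := key _ _ _ _ h'
      have : 0 < K q.1 q.2 * ((Lf p (v' q.1) (v' q.2) - Lf p (u' q.1) (u' q.2)) * (φ q.2 - φ q.1)) :=
        mul_pos hk (mul_pos (by linarith) (by linarith))
      linarith
    · exact h
    · have h' := h
      rw [h1, h2] at h'
      have := key _ _ _ _ h'
      rw [obs_Lf_symm p (u' q.2), obs_Lf_symm p (v' q.2)] at this
      have : 0 < K q.1 q.2 * ((Lf p (u' q.1) (u' q.2) - Lf p (v' q.1) (v' q.2)) * (φ q.1 - φ q.2)) :=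
        mul_pos hk (mul_pos (by linarith) (by linarith))
      linarith
  have hc2 := Measure.ae_ae_of_ae_prod hconst
  have hex : ∃ᵐ y ∂(volume : Measure (Euc n)), y ∉ Ω := by
    intro hc
    have h0 : volume (Ωᶜ) = 0 := by
      have : ∀ᵐ y ∂(volume : Measure (Euc n)), y ∈ Ω := by
        filter_upwards [hc] with y hy
        simpa using hy
      exact this
    have : Nonempty (Fin n) := ⟨⟨0, hn⟩⟩
    have : Nontrivial (Euc n) := inferInstance
    have : NoncompactSpace (Euc n) := NormedSpace.noncompactSpace ℝ _
    have h1 : volume (Set.univ : Set (Euc n)) = ∞ := measure_univ_of_isAddLeftInvariant _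
    have h2 : volume (Set.univ : Set (Euc n)) ≤ volume Ω + volume Ωᶜ := by
      rw [← Set.union_compl_self Ω]; exact measure_union_le _ _
    rw [h0, add_zero, h1] at h2
    exact absurd (h2.trans_lt hΩb.measure_lt_top) (lt_irrefl _)
  filter_upwards [hc2, hφmax, huu', hvv'] with x h1 h2 h3 h4
  obtain ⟨y, hy, hxy⟩ := (hex.and_eventually h1).exists
  rw [hφΩ y hy, h2] at hxy
  have := le_max_left (u' x - v' x) 0
  rw [h3, h4]; linarith
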